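/- arXiv:1507.04984 — 2 statements merged into one kernel-verified Lean document; each statement's English description precedes it below -/
import Mathlib

section
/- For natural numbers m and n, define p(m, j) = ∫_ℝ t^j · e^{−t²/2} · He_m(t)² dt and r(m, n) = ∫_ℝ t^{n+1} · D_m(t) · D_m'(t) dt, where D_m(t) = e^{−t²/4}·He_m(t) and D_m' is its derivative. Then 2(n + 2)(n + 3) · r(m, n) = 2(n + 3)(2m + 1) · p(m, n + 2) − (n + 4) · p(m, n + 4). -/
/-- The `m`-th probabilists' Hermite polynomial, as a real function. -/
noncomputable def He (m : ℕ) (t : ℝ) : ℝ := Polynomial.aeval t (Polynomial.hermite m)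

/-- The parabolic cylinder function `Dₘ(t) = e^{-t²/4} Heₘ(t)` of integer order. -/
noncomputable def D (m : ℕ) (t : ℝ) : ℝ := Real.exp (-t ^ 2 / 4) * He m t

theorem derivative_hermite_succ (m : ℕ) :
    Polynomial.derivative (Polynomial.hermite (m + 1)) =
      ((m : Polynomial ℤ) + 1) * Polynomial.hermite m := by
  induction m with
  | zero => simp
  | succ k ih =>
    rw [Polynomial.hermite_succ (k + 1)]
    simp only [Polynomial.derivative_sub, Polynomial.derivative_mul, Polynomial.derivative_X, ih,
      Polynomial.derivative_add, Polynomial.derivative_natCast, Polynomial.derivative_one]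
    rw [Polynomial.hermite_succ k]
    push_cast
    ring

/-- Hermite's differential equation. -/
theorem derivative_derivative_hermite (m : ℕ) :
    Polynomial.derivative (Polynomial.derivative (Polynomial.hermite m)) =
      Polynomial.X * Polynomial.derivative (Polynomial.hermite m)
        - (m : Polynomial ℤ) * Polynomial.hermite m := by
  have h := derivative_hermite_succ m
  rw [Polynomial.hermite_succ] at h
  simp only [Polynomial.derivative_sub, Polynomial.derivative_mul, Polynomial.derivative_X] at h
  linear_combination -h

theorem integrable_polynomial_mul_gaussian (P : Polynomial ℝ) :
    MeasureTheory.Integrable fun t : ℝ => P.eval t * Real.exp (-t ^ 2 / 2) := by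
  induction P using Polynomial.induction_on' with
  | add p q hp hq =>
    simp only [Polynomial.eval_add, add_mul]
    exact hp.add hq
  | monomial k a =>
    have h := integrable_rpow_mul_exp_neg_mul_sq (b := 1 / 2) (by norm_num) (s := k)
      (by linarith [k.cast_nonneg (α := ℝ)])
    refine (h.const_mul a).congr (.of_forall fun t => ?_)
    simp only [Real.rpow_natCast, Polynomial.eval_monomial, mul_assoc]
    ring_nf

theorem integral_polynomial_sub_mul_gaussian (P Q : Polynomial ℝ) :
    ∫ t : ℝ, (P - Q).eval t * Real.exp (-t ^ 2 / 2) =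
      (∫ t : ℝ, P.eval t * Real.exp (-t ^ 2 / 2)) - ∫ t : ℝ, Q.eval t * Real.exp (-t ^ 2 / 2) := by
  simp only [Polynomial.eval_sub, sub_mul]
  exact MeasureTheory.integral_sub (integrable_polynomial_mul_gaussian P)
    (integrable_polynomial_mul_gaussian Q)

theorem integral_C_mul_polynomial_mul_gaussian (a : ℝ) (P : Polynomial ℝ) :
    ∫ t : ℝ, (Polynomial.C a * P).eval t * Real.exp (-t ^ 2 / 2) =
      a * ∫ t : ℝ, P.eval t * Real.exp (-t ^ 2 / 2) := by
  simp only [Polynomial.eval_mul, Polynomial.eval_C, mul_assoc]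
  exact MeasureTheory.integral_const_mul _ _

theorem integral_derivative_sub_X_mul_gaussian (P : Polynomial ℝ) :
    ∫ t : ℝ, (Polynomial.derivative P - Polynomial.X * P).eval t * Real.exp (-t ^ 2 / 2) = 0 := by
  refine MeasureTheory.integral_eq_zero_of_hasDerivAt_of_integrable
    (f := fun t : ℝ => P.eval t * Real.exp (-t ^ 2 / 2)) (fun t => ?_)
    (integrable_polynomial_mul_gaussian _) (integrable_polynomial_mul_gaussian _)
  have h : HasDerivAt (fun t : ℝ => -t ^ 2 / 2) (-t) t :=
    ((hasDerivAt_pow 2 t).neg.div_const 2).congr_deriv (by norm_num; ring)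
  refine ((P.hasDerivAt t).mul h.exp).congr_deriv ?_
  simp only [Polynomial.eval_sub, Polynomial.eval_mul, Polynomial.eval_X]
  ring

theorem He_eq_eval (m : ℕ) (t : ℝ) :
    He m t = ((Polynomial.hermite m).map (Int.castRingHom ℝ)).eval t := by
  simp [He, Polynomial.aeval_def, Polynomial.eval_map]

theorem deriv_D (m : ℕ) (t : ℝ) :
    deriv (D m) t = Real.exp (-t ^ 2 / 4) *
      ((Polynomial.derivative ((Polynomial.hermite m).map (Int.castRingHom ℝ))).eval t
        - t / 2 * He m t) := by
  have h : HasDerivAt (fun t : ℝ => -t ^ 2 / 4) (-t / 2) t :=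
    ((hasDerivAt_pow 2 t).neg.div_const 4).congr_deriv (by norm_num; ring)
  have hH : HasDerivAt (He m)
      ((Polynomial.derivative ((Polynomial.hermite m).map (Int.castRingHom ℝ))).eval t) t := by
    rw [funext (He_eq_eval m)]
    exact Polynomial.hasDerivAt _ t
  refine (h.exp.mul hH).deriv.trans ?_
  ring

/-- With `p(m,j) = ∫ℝ tʲ e^{-t²/2} Heₘ(t)² dt` and `r(m,n) = ∫ℝ t^{n+1} Dₘ(t) Dₘ'(t) dt`,
one has `2(n+2)(n+3) r(m,n) = 2(n+3)(2m+1) p(m,n+2) - (n+4) p(m,n+4)`. -/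
theorem stmt14 (m n : ℕ) (p : ℕ → ℕ → ℝ) (r : ℕ → ℕ → ℝ)
    (hp : ∀ m' j : ℕ, p m' j = ∫ t : ℝ, t ^ j * Real.exp (-t ^ 2 / 2) * (He m' t) ^ 2)
    (hr : ∀ m' j : ℕ, r m' j = ∫ t : ℝ, t ^ (j + 1) * D m' t * deriv (D m') t) :
    2 * ((n : ℝ) + 2) * ((n : ℝ) + 3) * r m n =
      2 * ((n : ℝ) + 3) * (2 * (m : ℝ) + 1) * p m (n + 2) - ((n : ℝ) + 4) * p m (n + 4) := by
  set H : Polynomial ℝ := (Polynomial.hermite m).map (Int.castRingHom ℝ) with hH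
  have ode : Polynomial.derivative (Polynomial.derivative H) =
      Polynomial.X * Polynomial.derivative H - (m : Polynomial ℝ) * H := by
    have h := congrArg (Polynomial.map (Int.castRingHom ℝ)) (derivative_derivative_hermite m)
    simpa [hH, Polynomial.derivative_map] using h
  set K : Polynomial ℝ := Polynomial.derivative H - Polynomial.C (1 / 2) * Polynomial.X * H with hK
  have hpP (j : ℕ) :
      p m j = ∫ t : ℝ, (Polynomial.X ^ j * H ^ 2).eval t * Real.exp (-t ^ 2 / 2) := by
    rw [hp]
    congr 1 with t
    simp only [He_eq_eval, ← hH, Polynomial.eval_mul, Polynomial.eval_pow, Polynomial.eval_X]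
    ring
  have hrP : r m n =
      ∫ t : ℝ, (Polynomial.X ^ (n + 1) * H * K).eval t * Real.exp (-t ^ 2 / 2) := by
    rw [hr]
    congr 1 with t
    have he : Real.exp (-t ^ 2 / 2) = Real.exp (-t ^ 2 / 4) * Real.exp (-t ^ 2 / 4) := by
      rw [← Real.exp_add]
      ring_nf
    simp only [deriv_D, D, He_eq_eval, ← hH, hK, he, Polynomial.eval_mul, Polynomial.eval_pow,
      Polynomial.eval_X, Polynomial.eval_sub, Polynomial.eval_C]
    ring
  -- a primitive of the difference of the integrands, up to the Gaussian factor
  have key := integral_derivative_sub_X_mul_gaussian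
    (Polynomial.X ^ (n + 3) * (2 * K ^ 2 -
        Polynomial.C (1 / 2) * (Polynomial.X ^ 2 - Polynomial.C (4 * (m : ℝ) + 2)) * H ^ 2)
      - Polynomial.C (2 * ((n : ℝ) + 3)) * Polynomial.X ^ (n + 2) * H * K)
  symm
  rw [hrP, hpP, hpP, ← sub_eq_zero, ← key]
  simp only [← integral_C_mul_polynomial_mul_gaussian,
    ← integral_polynomial_sub_mul_gaussian]
  congr 1 with t
  simp only [hK, ode, Polynomial.derivative_sub, Polynomial.derivative_mul,
    Polynomial.derivative_pow, Polynomial.derivative_X,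
    Polynomial.derivative_C, Polynomial.derivative_ofNat, Polynomial.eval_mul,
    Polynomial.eval_pow, Polynomial.eval_X, Polynomial.eval_sub, Polynomial.eval_add,
    Polynomial.eval_C, Polynomial.eval_natCast, Polynomial.eval_ofNat, Polynomial.eval_zero,
    Polynomial.eval_one]
  push_cast
  ring
end

section
/- Let m be a natural number and k a real number with 0 < k < 1. Set μ₁ = −(1 + k²)(1 + 2m + 2m²)/8 and b₁(t) = 2μ₁ + ((1 + k²)/4)·(2 − t²(t² − 4m − 2)). Then ∫_0^∞ b₁(t) · e^{−t²/2} · He_m(t)² dt = 0; that is, the coefficient μ₁ = −(1+k²)(1+2m+2m²)/8 is exactly the value for which the solvability condition ∫_0^∞ b₁(t) D_m(t)² dt = 0 holds. -/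
open Polynomial MeasureTheory in
theorem integrable_eval_mul_exp_neg_sq_div_two (P : ℝ[X]) :
    Integrable fun t : ℝ => P.eval t * Real.exp (-t ^ 2 / 2) := by
  induction P using Polynomial.induction_on' with
  | add P Q hP hQ =>
    refine (hP.add hQ).congr (.of_forall fun t => ?_)
    simp [add_mul]
  | monomial n a =>
    have h := (integrable_rpow_mul_exp_neg_mul_sq (b := 1 / 2) (by norm_num)
      (s := n) (by linarith [n.cast_nonneg (α := ℝ)])).const_mul a
    refine h.congr (.of_forall fun t => ?_)
    simp only [eval_monomial, Real.rpow_natCast, mul_assoc]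
    ring_nf

open Polynomial in
theorem hasDerivAt_eval_mul_exp_neg_sq_div_two (P : ℝ[X]) (t : ℝ) :
    HasDerivAt (fun t : ℝ => P.eval t * Real.exp (-t ^ 2 / 2))
      ((derivative P - X * P).eval t * Real.exp (-t ^ 2 / 2)) t := by
  have hexp : HasDerivAt (fun t : ℝ => -t ^ 2 / 2) (-t) t := by
    refine ((hasDerivAt_pow 2 t).neg.div_const 2).congr_deriv ?_
    norm_num
    ring
  refine ((P.hasDerivAt t).mul hexp.exp).congr_deriv ?_
  simp
  ring

open Polynomial MeasureTheory in
/-- `∫₀^∞ (P' - tP) e^{-t²/2} dt = -P(0)`, since the integrand is `(P e^{-t²/2})'`. -/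
theorem integral_Ioi_derivative_sub_X_mul (P : ℝ[X]) :
    ∫ t in Set.Ioi (0 : ℝ), (derivative P - X * P).eval t * Real.exp (-t ^ 2 / 2)
      = -P.eval 0 := by
  have hderiv := hasDerivAt_eval_mul_exp_neg_sq_div_two P
  have hint := (integrable_eval_mul_exp_neg_sq_div_two
    (derivative P - X * P)).integrableOn (s := Set.Ioi 0)
  have hlim := tendsto_zero_of_hasDerivAt_of_integrableOn_Ioi (fun t _ => hderiv t) hint
    (integrable_eval_mul_exp_neg_sq_div_two P).integrableOn
  simpa using integral_Ioi_of_hasDerivAt_of_tendsto' (fun t _ => hderiv t) hint hlim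

open Polynomial in
/-- The Hermite differential equation. -/
theorem derivative_derivative_hermite_s15 (n : ℕ) :
    derivative (derivative (hermite n)) = X * derivative (hermite n) - (n : ℤ[X]) * hermite n := by
  induction n with
  | zero => simp
  | succ n ih =>
    have h : derivative (hermite (n + 1)) = ((n + 1 : ℕ) : ℤ[X]) * hermite n := by
      simp only [hermite_succ, derivative_sub, derivative_mul, derivative_X, ih]
      push_cast
      ring
    rw [h, derivative_natCast_mul, hermite_succ]
    ring

open Polynomial in
theorem eval_zero_hermite_mul_derivative (n : ℕ) :
    (hermite n * derivative (hermite n)).eval 0 = 0 := by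
  rw [eval_mul, ← coeff_zero_eq_eval_zero, ← coeff_zero_eq_eval_zero, coeff_derivative]
  rcases n.even_or_odd with h | h
  · rw [coeff_hermite_of_odd_add (n := n) (k := 0 + 1) (by simpa using h.add_one)]
    simp
  · rw [coeff_hermite_of_odd_add (n := n) (k := 0) (by simpa using h)]
    simp

open Polynomial in
/-- The solvability condition `∫₀^∞ b₁(t) Dₘ(t)² dt = 0` holds for the
eigenvalue coefficient `μ₁ = -(1+k²)(1+2m+2m²)/8`. -/
theorem stmt15 (m : ℕ) (k : ℝ) (hk : 0 < k) (hk1 : k < 1)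
    (μ₁ : ℝ) (hμ₁ : μ₁ = -(1 + k ^ 2) * (1 + 2 * (m : ℝ) + 2 * (m : ℝ) ^ 2) / 8)
    (b₁ : ℝ → ℝ)
    (hb₁ : ∀ t : ℝ, b₁ t =
      2 * μ₁ + ((1 + k ^ 2) / 4) * (2 - t ^ 2 * (t ^ 2 - 4 * (m : ℝ) - 2))) :
    ∫ t in Set.Ioi (0:ℝ), b₁ t * Real.exp (-t ^ 2 / 2) * (He m t) ^ 2 = 0 := by
  set H : Polynomial ℝ := (Polynomial.hermite m).map (Int.castRingHom ℝ) with hH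
  have hHe (t : ℝ) : He m t = H.eval t := by
    rw [He, hH, Polynomial.eval_map, Polynomial.aeval_def]
    rfl
  have hode : derivative (derivative H) = X * derivative H - (m : Polynomial ℝ) * H := by
    simpa [hH, derivative_map] using
      congrArg (Polynomial.map (Int.castRingHom ℝ)) (derivative_derivative_hermite_s15 m)
  have hzero : H.eval 0 * (derivative H).eval 0 = 0 := by
    have h := congrArg (Int.castRingHom ℝ) (eval_zero_hermite_mul_derivative m)
    rw [eval_mul, map_mul] at h
    simpa [hH, derivative_map, eval_zero_map] using h
  set P : Polynomial ℝ := C ((1 + k ^ 2) / 4) *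
    ((C ((m : ℝ) / 2 + 1) * X ^ 3 + C (3 / 2 - ((m : ℝ) + 1 / 2) * (m + 1)) * X) * H ^ 2
      + (C ((m : ℝ) + 1 / 2) * (1 + X ^ 2) - C (1 / 2) * (3 * X ^ 2 + X ^ 4)) * (H * derivative H)
      + (C (1 / 2) * X ^ 3 - C ((m : ℝ) + 1 / 2) * X) * derivative H ^ 2) with hP
  have hint := integral_Ioi_derivative_sub_X_mul P
  have hP0 : P.eval 0 = 0 := by
    simp [hP, hzero]
  rw [hP0, neg_zero] at hint
  refine Eq.trans (MeasureTheory.setIntegral_congr_fun measurableSet_Ioi fun t _ => ?_) hint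
  have hodet : (derivative (derivative H)).eval t
      = t * (derivative H).eval t - m * H.eval t := by
    simp [hode]
  have key : (derivative P - X * P).eval t = b₁ t * H.eval t ^ 2 := by
    rw [hb₁, hμ₁, hP]
    simp [derivative_pow, hodet]
    ring
  simp only [key, hHe]
  ring
end
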